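/- Let S be the relational language with one binary relation symbol S₀ and one unary relation symbol A, and let Q be the Boolean query on finite nonempty S-structures defined by: Q(D) = 1 if and only if either there exist elements a, b, c of D with b ≠ c such that S₀(a, b) and S₀(a, c) hold in D (i.e., S₀^D is not a partial function), or there exists an element x of D with A(x). Then Q is not a coFPP query. -/

import Mathlib

open FirstOrder

/-- The relational language with `m` unary relation symbols `C₁, …, C_m` (the colors). -/
def unaryLang (m : ℕ) : Language where
  Functions := fun _ => Empty
  Relations := fun l => match l with
    | 1 => Fin m
    | _ => Empty

instance (m : ℕ) : (unaryLang m).IsRelational :=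
  fun _ => inferInstanceAs (IsEmpty Empty)

/-- The structure for `unaryLang m` on `β` in which `Cᵢ` is interpreted by `P i`. -/
def unaryStructure {m : ℕ} {β : Type*} (P : Fin m → β → Prop) : (unaryLang m).Structure β where
  funMap := fun {_} f _ => f.elim
  RelMap := fun {l} r x =>
    match l, r, x with
    | 1, i, x => P i (x 0)

/-- The `i`-th color, as a unary relation symbol of `S_m = S.sum (unaryLang m)`. -/
def colorRel (S : Language) (m : ℕ) (i : Fin m) : (S.sum (unaryLang m)).Relations 1 :=
  Sum.inr i

/-- An `S_m`-structure is colored if every element satisfies exactly one color `Cᵢ`. -/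
def IsColored (S : Language) (m : ℕ) (M : Type*) (iM : (S.sum (unaryLang m)).Structure M) :
    Prop :=
  ∀ x : M, ∃! i : Fin m, iM.RelMap (colorRel S m i) (fun _ => x)

/-- The `m`-coloring of an `S`-structure `D` determined by the color assignment
`c : D → Fin m`, as an `S_m`-structure on the same domain whose `S`-reduct is `D`
(these are precisely the colored `S_m`-structures extending `D`). -/
def coloringStruct (S : Language) {m : ℕ} {D : Type*} [S.Structure D] (c : D → Fin m) :
    (S.sum (unaryLang m)).Structure D :=
  letI : (unaryLang m).Structure D := unaryStructure (fun i d => c d = i)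
  Language.sumStructure S (unaryLang m) D

/-- A Boolean query `Q` on finite nonempty `S`-structures is a coFPP query (the complement
of a forbidden patterns problem) if there are `m ≥ 1` and a finite family `P` of finite
colored `S_m`-structures (the patterns) such that for every finite nonempty `S`-structure
`D`: `Q(D) = 1` iff for every `m`-coloring of `D` (given by `c : D → Fin m`) some pattern
admits an `S_m`-homomorphism into the colored structure. -/
def IsCoFPP (S : Language)
    (Q : ∀ (D : Type), Finite D → Nonempty D → S.Structure D → Prop) : Prop :=
  ∃ m : ℕ, 1 ≤ m ∧
    ∃ (κ : Type) (_ : Finite κ) (P : κ → Type) (_ : ∀ j, Finite (P j))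
      (SP : ∀ j, (S.sum (unaryLang m)).Structure (P j)),
      (∀ j, IsColored S m (P j) (SP j)) ∧
      ∀ (D : Type) (iF : Finite D) (iN : Nonempty D) (iS : S.Structure D),
        (Q D iF iN iS ↔
          ∀ c : D → Fin m, ∃ j,
            Nonempty (@Language.Hom (S.sum (unaryLang m)) (P j) D (SP j)
              (@coloringStruct S m D iS c)))

/-- The relational language with one binary relation symbol `S₀` and one unary relation
symbol `A`. -/
def sigSA : Language where
  Functions := fun _ => Empty
  Relations := fun l => match l with
    | 1 => Unit
    | 2 => Unit
    | _ => Empty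

/-- The unary relation symbol `A`. -/
def relA : sigSA.Relations 1 := Unit.unit

/-- The binary relation symbol `S₀`. -/
def relS : sigSA.Relations 2 := Unit.unit

/-- The structure in which `S₀` is the full binary relation and `A` is empty. -/
def fullStr (D : Type) : sigSA.Structure D where
  funMap := fun {_} f _ => f.elim
  RelMap := fun {l} _ _ => l = 2

/-- The Boolean query `Q` on finite nonempty structures over the
language with one binary relation symbol `S₀` and one unary relation symbol `A`, defined
by: `Q(D) = 1` iff either `S₀^D` is not a partial function (there are `a, b, c` with
`b ≠ c`, `S₀(a, b)` and `S₀(a, c)`) or some element of `D` satisfies `A`, is not a coFPP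
query. -/
theorem query_nonfunctional_or_A_not_isCoFPP :
    ¬ IsCoFPP sigSA (fun D _ _ iS =>
      (∃ a b c : D, b ≠ c ∧ iS.RelMap relS ![a, b] ∧ iS.RelMap relS ![a, c]) ∨
      (∃ x : D, iS.RelMap relA ![x])) := by
  rintro ⟨m, hm, κ, _, P, _, SP, hcol, h⟩
  -- coFPP queries are preserved under homomorphisms, `Q` is not: collapse `Bool` to `Unit`
  have hU := (h Unit inferInstance inferInstance (fullStr Unit)).not.1 (by
    rintro (⟨a, b, c, hbc, -⟩ | ⟨x, hx⟩)
    · exact hbc rfl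
    · exact absurd (show (1 : ℕ) = 2 from hx) (by decide))
  have hB := (h Bool inferInstance inferInstance (fullStr Bool)).1
    (Or.inl ⟨true, true, false, by decide, (rfl : (2 : ℕ) = 2), (rfl : (2 : ℕ) = 2)⟩)
  apply hU
  intro c
  obtain ⟨j, ⟨f⟩⟩ := hB (fun _ => c ())
  refine ⟨j, ⟨@Language.Hom.mk _ _ _ (SP j) (@coloringStruct sigSA m Unit (fullStr Unit) c)
    (fun _ => ()) ?_ ?_⟩⟩
  · intro n g x
    rfl
  · intro n r x hr
    have h1 := @Language.Hom.map_rel' _ _ _ (SP j)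
      (@coloringStruct sigSA m Bool (fullStr Bool) (fun _ => c ())) f n r x hr
    rcases r with r | r
    · exact h1
    · match n, r, x, h1 with
      | 1, r, x, h1 => exact h1
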